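/- arXiv:2505.17961 — 2 statements merged into one kernel-verified Lean document; each statement's English description precedes it below -/
import Mathlib

section
/- Suppose the global propensity score satisfies e(X) = Σ_{k=1}^K ω_k(X)·e_k(X) almost surely, with membership weights ω_k(X) = P(H=k | X) summing to one, and that local overlap holds. Then for any nonnegative bounded random variable Z that is measurable with respect to σ(X, Y(0), Y(1)) (in particular Z = Y(1)²), one has E[ Z/e(X) ] ≤ Σ_{k=1}^K ρ_k·E[ Z/e_k(X) | H=k ], with equality if e_k(X) = e(X) almost surely for all k; the analogous inequality holds with e replaced by 1−e and e_k by 1−e_k. -/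
open MeasureTheory ProbabilityTheory
open scoped ENNReal

/-- Conditioning an event about `f` on `k` and `g` is the same as conditioning it on `k` alone when
`f` and `g` are conditionally independent given `k`. -/
lemma condExp_preimage_prodMk_of_condIndepFun {Ω α β γ : Type*}
    {mΩ : MeasurableSpace Ω} [StandardBorelSpace Ω]
    [mα : MeasurableSpace α] [StandardBorelSpace α] [Nonempty α]
    [mβ : MeasurableSpace β] [StandardBorelSpace β] [Nonempty β] [mγ : MeasurableSpace γ]
    {μ : Measure Ω} [IsFiniteMeasure μ] {f : Ω → α} {g : Ω → β} {k : Ω → γ}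
    (hf : Measurable f) (hg : Measurable g) (hk : Measurable k)
    (h : CondIndepFun (mγ.comap k) hk.comap_le g f μ) {s : Set α} (hs : MeasurableSet s) :
    μ[(f ⁻¹' s).indicator (fun _ => (1 : ℝ)) |
        MeasurableSpace.comap (fun ω => (k ω, g ω)) inferInstance]
      =ᵐ[μ] μ[(f ⁻¹' s).indicator (fun _ => (1 : ℝ)) | mγ.comap k] := by
  have hkg : Measurable fun ω => (k ω, g ω) := hk.prodMk hg
  have heq := ae_of_ae_map hkg.aemeasurable
    ((condIndepFun_iff_condDistrib_prod_ae_eq_prodMkRight hf hg hk).1 h)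
  filter_upwards [condDistrib_ae_eq_condExp (μ := μ) hkg hf hs,
    condDistrib_ae_eq_condExp (μ := μ) hk hf hs, heq] with ω h1 h2 h3
  rw [← h1, ← h2, h3, Kernel.prodMkRight_apply]

section SubSigmaAlgebra

variable {Ω : Type*} {m mΩ : MeasurableSpace Ω} {μ : Measure Ω}

lemma condProb_nonneg {s : Set Ω} {p : Ω → ℝ}
    (hp : μ[s.indicator (fun _ => (1 : ℝ)) | m] =ᵐ[μ] p) : ∀ᵐ ω ∂μ, 0 ≤ p ω := by
  have h : 0 ≤ᵐ[μ] μ[s.indicator (fun _ => (1 : ℝ)) | m] :=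
    condExp_nonneg (.of_forall fun ω => Set.indicator_nonneg (fun _ _ => zero_le_one) ω)
  filter_upwards [h, hp] with ω h1 h2
  rwa [← h2]

variable [IsFiniteMeasure μ]

lemma measure_smul_cond {s : Set Ω} : μ s • μ[|s] = μ.restrict s := by
  by_cases h : μ s = 0
  · simp [h, Measure.restrict_eq_zero.2 h]
  · rw [ProbabilityTheory.cond, smul_smul, ENNReal.mul_inv_cancel h (measure_ne_top μ s), one_smul]

lemma toReal_measure_mul_integral_cond {s : Set Ω} (f : Ω → ℝ) :
    (μ s).toReal * ∫ ω, f ω ∂μ[|s] = ∫ ω in s, f ω ∂μ := by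
  rw [← measure_smul_cond, integral_smul_measure, smul_eq_mul]

lemma condExp_indicator_mul_ae_eq {s : Set Ω} (hs : MeasurableSet s) {p G : Ω → ℝ}
    (hp : μ[s.indicator (fun _ => (1 : ℝ)) | m] =ᵐ[μ] p)
    (hG : StronglyMeasurable[m] G) (hGs : IntegrableOn G s μ) :
    μ[s.indicator G | m] =ᵐ[μ] fun ω => G ω * p ω := by
  have heq : s.indicator G = G * s.indicator (fun _ => (1 : ℝ)) := by
    ext ω
    by_cases hω : ω ∈ s <;> simp [hω]
  rw [← integrable_indicator_iff hs, heq] at hGs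
  rw [heq]
  filter_upwards [condExp_mul_of_stronglyMeasurable_left hG hGs
    ((integrable_const (1 : ℝ)).indicator hs), hp] with ω h1 h2
  rw [h1, Pi.mul_apply, h2]

lemma integrable_mul_condProb {s : Set Ω} (hs : MeasurableSet s) {p G : Ω → ℝ}
    (hp : μ[s.indicator (fun _ => (1 : ℝ)) | m] =ᵐ[μ] p)
    (hG : StronglyMeasurable[m] G) (hGs : IntegrableOn G s μ) :
    Integrable (fun ω => G ω * p ω) μ :=
  integrable_condExp.congr (condExp_indicator_mul_ae_eq hs hp hG hGs)

lemma integral_mul_condProb (hm : m ≤ mΩ) {s : Set Ω} (hs : MeasurableSet s) {p G : Ω → ℝ}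
    (hp : μ[s.indicator (fun _ => (1 : ℝ)) | m] =ᵐ[μ] p)
    (hG : StronglyMeasurable[m] G) (hGs : IntegrableOn G s μ) :
    ∫ ω, G ω * p ω ∂μ = ∫ ω in s, G ω ∂μ := by
  rw [← integral_congr_ae (condExp_indicator_mul_ae_eq hs hp hG hGs), integral_condExp hm,
    integral_indicator hs]

/-- An `m`-measurable property which holds almost surely on `s` holds almost surely wherever the
conditional probability of `s` given `m` does not vanish. -/
lemma ae_of_condProb_ne_zero (hm : m ≤ mΩ) {s : Set Ω} (hs : MeasurableSet s) {p : Ω → ℝ}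
    (hp : μ[s.indicator (fun _ => (1 : ℝ)) | m] =ᵐ[μ] p) {t : Set Ω} (ht : MeasurableSet[m] t)
    (hst : ∀ᵐ ω ∂μ.restrict s, ω ∈ t) : ∀ᵐ ω ∂μ, p ω ≠ 0 → ω ∈ t := by
  set G : Ω → ℝ := tᶜ.indicator fun _ => 1 with hGdef
  have hG : StronglyMeasurable[m] G := stronglyMeasurable_const.indicator ht.compl
  have hGs : IntegrableOn G s μ := ((integrable_const 1).indicator (hm _ ht.compl)).integrableOn
  have hzero : ∫ ω in s, G ω ∂μ = 0 := by
    refine integral_eq_zero_of_ae ?_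
    filter_upwards [hst] with ω hω
    simp [hGdef, hω]
  rw [← integral_mul_condProb hm hs hp hG hGs, integral_eq_zero_iff_of_nonneg_ae _
    (integrable_mul_condProb hs hp hG hGs)] at hzero
  · filter_upwards [hzero] with ω hω hpω
    by_contra hωt
    simp [hGdef, hωt, hpω] at hω
  · filter_upwards [condProb_nonneg hp] with ω hω
    exact mul_nonneg (Set.indicator_nonneg (fun _ _ => zero_le_one) ω) hω

lemma sum_condProb_fiber_eq_one (hm : m ≤ mΩ) {μ : Measure Ω} [IsProbabilityMeasure μ]
    {ι : Type*} [Fintype ι] [MeasurableSpace ι] [MeasurableSingletonClass ι]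
    {H : Ω → ι} (hH : Measurable H) {p : ι → Ω → ℝ}
    (hp : ∀ k, μ[{ω | H ω = k}.indicator (fun _ => (1 : ℝ)) | m] =ᵐ[μ] p k) :
    ∀ᵐ ω ∂μ, ∑ k, p k ω = 1 := by
  have hsum : ∑ k, {ω | H ω = k}.indicator (fun _ => (1 : ℝ)) = fun _ : Ω => (1 : ℝ) := by
    classical
    ext ω
    simp [Finset.sum_apply, Set.indicator_apply]
  have h := condExp_finsetSum (μ := μ) (s := Finset.univ)
    (f := fun k => {ω | H ω = k}.indicator (fun _ => (1 : ℝ)))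
    (fun k _ => (integrable_const (1 : ℝ)).indicator (hH (measurableSet_singleton k))) m
  rw [hsum, condExp_const hm] at h
  filter_upwards [h, ae_all_iff.2 hp] with ω h1 h2
  rw [h1, Finset.sum_apply]
  exact Finset.sum_congr rfl fun k _ => (h2 k).symm

end SubSigmaAlgebra

lemma inv_sum_mul_le_sum_mul_inv {ι : Type*} [Fintype ι] {w a : ι → ℝ} (hw : ∀ i, 0 ≤ w i)
    (hw1 : ∑ i, w i = 1) (ha : ∀ i, w i ≠ 0 → 0 < a i) :
    0 < ∑ i, w i * a i ∧ (∑ i, w i * a i)⁻¹ ≤ ∑ i, (a i)⁻¹ * w i := by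
  have hwa : ∀ i, 0 ≤ w i * a i ∧ 0 ≤ (a i)⁻¹ * w i ∧
      w i ^ 2 ≤ w i * a i * ((a i)⁻¹ * w i) := fun i => by
    rcases eq_or_ne (w i) 0 with h | h
    · simp [h]
    · have hai := ha i h
      refine ⟨mul_nonneg (hw i) hai.le, mul_nonneg (inv_nonneg.2 hai.le) (hw i), le_of_eq ?_⟩
      field_simp
  have h := Finset.sum_sq_le_sum_mul_sum_of_sq_le_mul Finset.univ (fun i _ => (hwa i).1)
    (fun i _ => (hwa i).2.1) (fun i _ => (hwa i).2.2)
  rw [hw1, one_pow] at h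
  have hpos : 0 < ∑ i, w i * a i :=
    (Finset.sum_nonneg fun i _ => (hwa i).1).lt_of_ne' fun h0 => by
      rw [h0, zero_mul] at h
      exact absurd h (by norm_num)
  exact ⟨hpos, (inv_le_iff_one_le_mul₀' hpos).2 h⟩

/-- Jensen's inequality for the reciprocal of a mixture `b = ∑ k, p k * a k` whose weights are the
conditional probabilities of the fibers of `H`. -/
lemma integral_div_mixture_le_sum {Ω : Type*} {m mΩ : MeasurableSpace Ω} (hm : m ≤ mΩ)
    {μ : Measure Ω} [IsProbabilityMeasure μ]
    {ι : Type*} [Fintype ι] [MeasurableSpace ι] [MeasurableSingletonClass ι]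
    {H : Ω → ι} (hH : Measurable H) {p a : ι → Ω → ℝ} {b Z : Ω → ℝ}
    (hp : ∀ k, μ[{ω | H ω = k}.indicator (fun _ => (1 : ℝ)) | m] =ᵐ[μ] p k)
    (ha : ∀ k, Measurable[m] (a k))
    (hapos : ∀ k, ∀ᵐ ω ∂μ.restrict {ω | H ω = k}, 0 < a k ω)
    (hb : ∀ᵐ ω ∂μ, b ω = ∑ k, p k ω * a k ω)
    (hZ : Measurable[m] Z) (hZnn : ∀ ω, 0 ≤ Z ω)
    (hint : ∀ k, IntegrableOn (fun ω => Z ω / a k ω) {ω | H ω = k} μ) :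
    ∫ ω, Z ω / b ω ∂μ ≤ ∑ k, ∫ ω in {ω | H ω = k}, Z ω / a k ω ∂μ := by
  have hS : ∀ k, MeasurableSet {ω | H ω = k} := fun k => hH (measurableSet_singleton k)
  have hG : ∀ k, StronglyMeasurable[m] fun ω => Z ω / a k ω :=
    fun k => (hZ.div (ha k)).stronglyMeasurable
  have hI : ∀ k, Integrable (fun ω => Z ω / a k ω * p k ω) μ :=
    fun k => integrable_mul_condProb (hS k) (hp k) (hG k) (hint k)
  have hbound : ∀ᵐ ω ∂μ, 0 < b ω ∧ Z ω / b ω ≤ ∑ k, Z ω / a k ω * p k ω := by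
    have hpos : ∀ k, ∀ᵐ ω ∂μ, p k ω ≠ 0 → ω ∈ {ω | 0 < a k ω} := fun k =>
      ae_of_condProb_ne_zero hm (hS k) (hp k) (ha k measurableSet_Ioi) (hapos k)
    filter_upwards [hb, sum_condProb_fiber_eq_one hm hH hp,
      ae_all_iff.2 fun k => condProb_nonneg (hp k), ae_all_iff.2 hpos] with ω hbω h1 h0 ha0
    obtain ⟨hbpos, hle⟩ := inv_sum_mul_le_sum_mul_inv h0 h1 ha0
    rw [hbω]
    refine ⟨hbpos, ?_⟩
    simpa only [div_eq_mul_inv, Finset.mul_sum, mul_assoc] using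
      mul_le_mul_of_nonneg_left hle (hZnn ω)
  calc ∫ ω, Z ω / b ω ∂μ
      ≤ ∫ ω, ∑ k, Z ω / a k ω * p k ω ∂μ := by
        refine integral_mono_of_nonneg ?_ (integrable_finsetSum _ fun k _ => hI k) ?_
        · filter_upwards [hbound] with ω h
          exact div_nonneg (hZnn ω) h.1.le
        · filter_upwards [hbound] with ω h
          exact h.2
    _ = ∑ k, ∫ ω in {ω | H ω = k}, Z ω / a k ω ∂μ := by
        rw [integral_finsetSum _ fun k _ => hI k]
        exact Finset.sum_congr rfl fun k _ => integral_mul_condProb hm (hS k) (hp k) (hG k) (hint k)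

/-- Jensen-type comparison: if `e(X) = Σ_k ω_k(X)·e_k(X)` a.s. with membership weights and local overlap holds, then for any nonnegative bounded `Z` measurable w.r.t. `σ(X,Y(0),Y(1))`, `E[Z/e(X)] ≤ Σ_k ρ_k·E[Z/e_k(X) | H=k]`, with equality if all `e_k(X) = e(X)` a.s.; analogously with `e` replaced by `1−e`. -/
theorem jensen_weighted_inverse_propensity
    {Ω : Type*} [MeasurableSpace Ω] [StandardBorelSpace Ω] [Nonempty Ω]
    (μ : Measure Ω) [IsProbabilityMeasure μ]
    {d K : ℕ}
    (X : Ω → (Fin d → ℝ)) (H : Ω → Fin K) (W : Ω → ℝ) (Y1 Y0 Y : Ω → ℝ)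
    (hX : Measurable X) (hH : Measurable H) (hW : Measurable W)
    (hY1 : Measurable Y1) (hY0 : Measurable Y0)
    -- W is a binary treatment
    (hWbin : ∀ ω, W ω = 0 ∨ W ω = 1)
    -- uniformly bounded potential outcomes
    (C : ℝ) (hY1bdd : ∀ ω, |Y1 ω| ≤ C) (hY0bdd : ∀ ω, |Y0 ω| ≤ C)
    -- SUTVA: observed outcome
    (hSUTVA : ∀ ω, Y ω = W ω * Y1 ω + (1 - W ω) * Y0 ω)
    -- global propensity score: e(X) is a version of E[W | X]
    (e : (Fin d → ℝ) → ℝ) (he : Measurable e)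
    (heX : μ[W | MeasurableSpace.comap X inferInstance] =ᵐ[μ] fun ω => e (X ω))
    -- local propensity scores: e_k(X) is a version of E[W | X] under μ(·|H=k)
    (ek : Fin K → (Fin d → ℝ) → ℝ) (hekMeas : ∀ k, Measurable (ek k))
    (hekX : ∀ k : Fin K, (μ[|{ω | H ω = k}])[W | MeasurableSpace.comap X inferInstance]
      =ᵐ[μ[|{ω | H ω = k}]] fun ω => ek k (X ω))
    -- local overlap
    (hLocOverlap : ∀ k : Fin K,
      Integrable (fun ω => (ek k (X ω) * (1 - ek k (X ω)))⁻¹) (μ[|{ω | H ω = k}]))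
    (hLocOverlap' : ∀ k : Fin K,
      ∀ᵐ ω ∂(μ[|{ω | H ω = k}]), 0 < ek k (X ω) ∧ ek k (X ω) < 1)
    -- membership weights: ω_k(X) is a version of P(H=k | X)
    (w : Fin K → (Fin d → ℝ) → ℝ) (hwMeas : ∀ k, Measurable (w k))
    (hwX : ∀ k : Fin K,
      μ[Set.indicator {ω | H ω = k} (fun _ => (1:ℝ)) | MeasurableSpace.comap X inferInstance]
        =ᵐ[μ] fun ω => w k (X ω))
    -- mixture decomposition of the global propensity score
    (hMix : ∀ᵐ ω ∂μ, e (X ω) = ∑ k : Fin K, w k (X ω) * ek k (X ω))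
    -- ignorability on sites: (Y(0),Y(1)) ⫫ H | X
    (hIgn : CondIndepFun (MeasurableSpace.comap X inferInstance) hX.comap_le
      (fun ω => (Y0 ω, Y1 ω)) H μ)
    -- Z nonnegative, bounded, measurable w.r.t. σ(X, Y(0), Y(1))
    (Z : Ω → ℝ)
    (hZmeas : Measurable[MeasurableSpace.comap (fun ω => (X ω, Y0 ω, Y1 ω)) inferInstance] Z)
    (hZnn : ∀ ω, 0 ≤ Z ω) (CZ : ℝ) (hZbdd : ∀ ω, Z ω ≤ CZ) :
    ((∫ ω, Z ω / e (X ω) ∂μ)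
        ≤ ∑ k : Fin K, (μ {ω | H ω = k}).toReal *
            ∫ ω, Z ω / ek k (X ω) ∂(μ[|{ω | H ω = k}]))
    ∧ ((∀ k : Fin K, (fun ω => ek k (X ω)) =ᵐ[μ] fun ω => e (X ω)) →
        (∫ ω, Z ω / e (X ω) ∂μ)
          = ∑ k : Fin K, (μ {ω | H ω = k}).toReal *
              ∫ ω, Z ω / ek k (X ω) ∂(μ[|{ω | H ω = k}]))
    ∧ ((∫ ω, Z ω / (1 - e (X ω)) ∂μ)
        ≤ ∑ k : Fin K, (μ {ω | H ω = k}).toReal *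
            ∫ ω, Z ω / (1 - ek k (X ω)) ∂(μ[|{ω | H ω = k}])) := by
  have hXY : Measurable fun ω => (X ω, Y0 ω, Y1 ω) := hX.prodMk (hY0.prodMk hY1)
  have hm := hXY.comap_le
  have hXm : Measurable[MeasurableSpace.comap (fun ω => (X ω, Y0 ω, Y1 ω)) inferInstance] X :=
    measurable_fst.comp (comap_measurable fun ω => (X ω, Y0 ω, Y1 ω))
  have hS : ∀ k, MeasurableSet {ω | H ω = k} := fun k => hH (measurableSet_singleton k)
  have hp : ∀ k, μ[{ω | H ω = k}.indicator (fun _ => (1 : ℝ)) |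
      MeasurableSpace.comap (fun ω => (X ω, Y0 ω, Y1 ω)) inferInstance]
        =ᵐ[μ] fun ω => w k (X ω) := by
    intro k
    have : Nonempty (Fin K) := ⟨k⟩
    exact (condExp_preimage_prodMk_of_condIndepFun hH (hY0.prodMk hY1) hX hIgn
      (measurableSet_singleton k)).trans (hwX k)
  have hoverlap : ∀ k, ∀ᵐ ω ∂μ.restrict {ω | H ω = k}, 0 < ek k (X ω) ∧ ek k (X ω) < 1 := by
    intro k
    rw [← measure_smul_cond]
    exact Measure.ae_smul_measure (hLocOverlap' k) _
  have hdom : ∀ k (a : (Fin d → ℝ) → ℝ), Measurable a →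
      (∀ x, 0 < ek k x ∧ ek k x < 1 → 0 < a x ∧ ek k x * (1 - ek k x) ≤ a x) →
      IntegrableOn (fun ω => Z ω / a (X ω)) {ω | H ω = k} μ := by
    intro k a ham ha
    have hint : IntegrableOn (fun ω => (ek k (X ω) * (1 - ek k (X ω)))⁻¹) {ω | H ω = k} μ := by
      rw [IntegrableOn, ← measure_smul_cond]
      exact (hLocOverlap k).smul_measure (measure_ne_top μ _)
    refine (hint.const_mul CZ).mono'
      ((hZmeas.mono hm le_rfl).div (ham.comp hX)).aestronglyMeasurable ?_
    filter_upwards [hoverlap k] with ω hω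
    obtain ⟨hapos, hle⟩ := ha _ hω
    rw [Real.norm_of_nonneg (div_nonneg (hZnn ω) hapos.le), div_eq_mul_inv]
    exact mul_le_mul (hZbdd ω) (inv_anti₀ (mul_pos hω.1 (sub_pos.2 hω.2)) hle)
      (inv_nonneg.2 hapos.le) ((hZnn ω).trans (hZbdd ω))
  have hint : ∀ k, IntegrableOn (fun ω => Z ω / ek k (X ω)) {ω | H ω = k} μ := fun k =>
    hdom k (ek k) (hekMeas k) fun x hx => ⟨hx.1, by nlinarith⟩
  have hint' : ∀ k, IntegrableOn (fun ω => Z ω / (1 - ek k (X ω))) {ω | H ω = k} μ := fun k =>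
    hdom k (fun x => 1 - ek k x) (measurable_const.sub (hekMeas k))
      fun x hx => ⟨sub_pos.2 hx.2, by nlinarith⟩
  simp only [toReal_measure_mul_integral_cond]
  refine ⟨?_, fun heq => ?_, ?_⟩
  · exact integral_div_mixture_le_sum hm hH hp (fun k => (hekMeas k).comp hXm)
      (fun k => (hoverlap k).mono fun _ h => h.1) hMix hZmeas hZnn hint
  · have hcongr : ∀ k, (fun ω => Z ω / ek k (X ω)) =ᵐ[μ.restrict {ω | H ω = k}]
        fun ω => Z ω / e (X ω) := fun k =>
      ae_restrict_of_ae ((heq k).mono fun ω h => by simp only at h ⊢; rw [h])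
    simp_rw [fun k => integral_congr_ae (hcongr k)]
    rw [← integral_iUnion_fintype hS ?_ fun k => (hint k).congr (hcongr k)]
    · rw [show ⋃ k, {ω | H ω = k} = Set.univ by ext; simp, setIntegral_univ]
    · exact fun i j hij => Set.disjoint_left.2 fun ω hi hj => hij (hi.symm.trans hj)
  · refine integral_div_mixture_le_sum hm hH hp
      (fun k => (measurable_const.sub (hekMeas k)).comp hXm)
      (fun k => (hoverlap k).mono fun _ h => sub_pos.2 h.2) ?_ hZmeas hZnn hint'
    filter_upwards [hMix, sum_condProb_fiber_eq_one hm hH hp] with ω h1 h2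
    simp [mul_sub, Finset.sum_sub_distrib, h1, h2]
end

section
/- Overlap improvement: the global overlap functional is bounded by the site-proportion-weighted average of the local overlap functionals, i.e., 0 ≤ O_global ≤ Σ_{k=1}^K ρ_k·O_k, where O_global = E[ (e(X)(1−e(X)))^{-1} ] and O_k = E[ (e_k(X)(1−e_k(X)))^{-1} | H=k ], given that e(X) = Σ_{k=1}^K P(H=k | X)·e_k(X) almost surely and 0 < e_k(X) < 1 almost surely on {H=k} for each k. -/
open MeasureTheory ProbabilityTheory
open scoped ENNReal

lemma inv_tangent_le {a b : ℝ} (ha : 0 < a) (hb : 0 < b) :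
    a⁻¹ - (b - a) * (a ^ 2)⁻¹ ≤ b⁻¹ := by
  have h : b⁻¹ - (a⁻¹ - (b - a) * (a ^ 2)⁻¹) = (b - a) ^ 2 * (a ^ 2 * b)⁻¹ := by
    field_simp
    ring
  have : 0 ≤ (b - a) ^ 2 * (a ^ 2 * b)⁻¹ := by positivity
  linarith

lemma inv_mul_one_sub {t : ℝ} (h0 : 0 < t) (h1 : t < 1) :
    (t * (1 - t))⁻¹ = t⁻¹ + (1 - t)⁻¹ := by
  have : 1 - t ≠ 0 := by linarith
  field_simp
  ring

/-- Jensen's inequality for `t ↦ 1 / (t (1 - t))` on `(0, 1)`. -/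
lemma inv_mul_one_sub_sum_le {ι : Type*} [Fintype ι] (w s : ι → ℝ)
    (hw : ∀ i, 0 ≤ w i) (hw1 : ∑ i, w i = 1) (hs : ∀ i, w i ≠ 0 → 0 < s i ∧ s i < 1) :
    ((∑ i, w i * s i) * (1 - ∑ i, w i * s i))⁻¹ ≤ ∑ i, w i * (s i * (1 - s i))⁻¹ := by
  obtain ⟨j, -, hj⟩ := Finset.exists_ne_zero_of_sum_ne_zero (hw1.trans_ne one_ne_zero)
  have pos_sum : ∀ r : ι → ℝ, (∀ i, w i ≠ 0 → 0 < r i) → 0 < ∑ i, w i * r i := by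
    intro r hr
    refine Finset.sum_pos' (fun i _ => ?_) ⟨j, Finset.mem_univ j,
      mul_pos (lt_of_le_of_ne (hw j) hj.symm) (hr j hj)⟩
    by_cases h : w i = 0
    · simp [h]
    · exact mul_nonneg (hw i) (hr i h).le
  have h0 := pos_sum s fun i hi => (hs i hi).1
  have h1 := pos_sum (fun i => 1 - s i) fun i hi => sub_pos.2 (hs i hi).2
  simp only [mul_sub, mul_one, Finset.sum_sub_distrib, hw1] at h1
  set t := ∑ i, w i * s i with ht
  set c := ((1 - t) ^ 2)⁻¹ - (t ^ 2)⁻¹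
  have tangent : ∀ i, w i * ((t * (1 - t))⁻¹ + (s i - t) * c) ≤ w i * (s i * (1 - s i))⁻¹ := by
    intro i
    by_cases h : w i = 0
    · simp [h]
    refine mul_le_mul_of_nonneg_left ?_ (hw i)
    obtain ⟨hs0, hs1⟩ := hs i h
    rw [inv_mul_one_sub h0 (by linarith), inv_mul_one_sub hs0 hs1]
    have ha := inv_tangent_le h0 hs0
    have hb := inv_tangent_le h1 (sub_pos.2 hs1)
    simp only [c]
    linarith
  calc (t * (1 - t))⁻¹ = ∑ i, w i * ((t * (1 - t))⁻¹ + (s i - t) * c) := by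
        have : ∀ i, w i * ((t * (1 - t))⁻¹ + (s i - t) * c)
            = w i * ((t * (1 - t))⁻¹ - t * c) + w i * s i * c := fun i => by ring
        simp only [this, Finset.sum_add_distrib, ← Finset.sum_mul, hw1, ← ht]
        ring
    _ ≤ _ := Finset.sum_le_sum fun i _ => tangent i

/-- If `w ∘ X` is a version of `P(A | X)`, then it is the density with respect to the law of `X`
of the law of `X` restricted to `A`. -/
lemma map_restrict_eq_withDensity {Ω S : Type*} [MeasurableSpace Ω] [MeasurableSpace S]
    (μ : Measure Ω) [IsFiniteMeasure μ] {X : Ω → S} (hX : Measurable X)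
    {A : Set Ω} (hA : MeasurableSet A) {w : S → ℝ} (hw : Measurable w)
    (hwX : μ[A.indicator (fun _ => (1 : ℝ)) | MeasurableSpace.comap X inferInstance]
      =ᵐ[μ] fun ω => w (X ω)) :
    (μ.restrict A).map X = (μ.map X).withDensity (fun x => ENNReal.ofReal (w x)) := by
  have hint : Integrable (A.indicator (fun _ => (1 : ℝ))) μ :=
    (integrable_const 1).indicator hA
  have hw0 : ∀ᵐ ω ∂μ, 0 ≤ w (X ω) := by
    have h := condExp_nonneg (m := MeasurableSpace.comap X inferInstance) (μ := μ)
      (f := A.indicator (fun _ => (1 : ℝ)))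
      (Filter.Eventually.of_forall (Set.indicator_nonneg fun _ _ => zero_le_one))
    filter_upwards [h, hwX] with ω h1 h2
    rw [← h2]
    exact h1
  ext B hB
  rw [Measure.map_apply hX hB, Measure.restrict_apply (hX hB), withDensity_apply _ hB,
    setLIntegral_map hB hw.ennreal_ofReal hX,
    ← ofReal_integral_eq_lintegral_ofReal (integrable_condExp.congr hwX).integrableOn
      (ae_restrict_of_ae hw0),
    ← setIntegral_congr_ae (hX hB) (hwX.mono fun _ h _ => h),
    setIntegral_condExp hX.comap_le hint ⟨B, hB, rfl⟩, setIntegral_indicator hA]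
  simp

/-- Overlap improvement: `0 ≤ O_global ≤ Σ_k ρ_k·O_k`, where `O_global = E[(e(X)(1−e(X)))⁻¹]` and `O_k = E[(e_k(X)(1−e_k(X)))⁻¹ | H=k]`. -/
theorem overlap_improvement
    {Ω : Type*} [MeasurableSpace Ω] [StandardBorelSpace Ω] [Nonempty Ω]
    (μ : Measure Ω) [IsProbabilityMeasure μ]
    {d K : ℕ}
    (X : Ω → (Fin d → ℝ)) (H : Ω → Fin K) (W : Ω → ℝ)
    (hX : Measurable X) (hH : Measurable H) (hW : Measurable W)
    (hWbin : ∀ ω, W ω = 0 ∨ W ω = 1)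
    -- global propensity score: e(X) is a version of E[W | X]
    (e : (Fin d → ℝ) → ℝ) (he : Measurable e)
    (heX : μ[W | MeasurableSpace.comap X inferInstance] =ᵐ[μ] fun ω => e (X ω))
    -- local propensity scores: e_k(X) is a version of E[W | X] under μ(·|H=k)
    (ek : Fin K → (Fin d → ℝ) → ℝ) (hekMeas : ∀ k, Measurable (ek k))
    (hekX : ∀ k : Fin K, (μ[|{ω | H ω = k}])[W | MeasurableSpace.comap X inferInstance]
      =ᵐ[μ[|{ω | H ω = k}]] fun ω => ek k (X ω))
    -- membership weights: ω_k(X) is a version of P(H=k | X)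
    (w : Fin K → (Fin d → ℝ) → ℝ) (hwMeas : ∀ k, Measurable (w k))
    (hwX : ∀ k : Fin K,
      μ[Set.indicator {ω | H ω = k} (fun _ => (1:ℝ)) | MeasurableSpace.comap X inferInstance]
        =ᵐ[μ] fun ω => w k (X ω))
    -- mixture decomposition of the global propensity score
    (hMix : ∀ᵐ ω ∂μ, e (X ω) = ∑ k : Fin K, w k (X ω) * ek k (X ω))
    -- local propensity scores bounded away from 0 and 1 a.s. on each site
    (hLoc : ∀ k : Fin K, ∀ᵐ ω ∂(μ[|{ω | H ω = k}]), 0 < ek k (X ω) ∧ ek k (X ω) < 1) :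
    (0 : ℝ≥0∞) ≤ (∫⁻ ω, ENNReal.ofReal ((e (X ω) * (1 - e (X ω)))⁻¹) ∂μ)
    ∧ (∫⁻ ω, ENNReal.ofReal ((e (X ω) * (1 - e (X ω)))⁻¹) ∂μ)
        ≤ ∑ k : Fin K, μ {ω | H ω = k} *
            ∫⁻ ω, ENNReal.ofReal ((ek k (X ω) * (1 - ek k (X ω)))⁻¹) ∂(μ[|{ω | H ω = k}]) := by
  refine ⟨zero_le, ?_⟩
  have hA : ∀ k, MeasurableSet {ω | H ω = k} := fun k => hH (measurableSet_singleton k)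
  have hlaw := fun k => map_restrict_eq_withDensity μ hX (hA k) (hwMeas k) (hwX k)
  have hw0 : ∀ᵐ ω ∂μ, ∀ k, 0 ≤ w k (X ω) := by
    refine ae_all_iff.2 fun k => ?_
    have h := condExp_nonneg (m := MeasurableSpace.comap X inferInstance) (μ := μ)
      (f := Set.indicator {ω | H ω = k} (fun _ => (1 : ℝ)))
      (Filter.Eventually.of_forall (Set.indicator_nonneg fun _ _ => zero_le_one))
    filter_upwards [h, hwX k] with ω h1 h2
    rw [← h2]
    exact h1
  have hw1 : ∀ᵐ ω ∂μ, ∑ k, w k (X ω) = 1 := by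
    have hsum : (∑ k, Set.indicator {ω | H ω = k} (fun _ => (1 : ℝ))) = fun _ => 1 := by
      ext ω
      simp [Finset.sum_apply, Set.indicator_apply]
    have h := condExp_finsetSum (μ := μ) (s := Finset.univ)
      (f := fun k => Set.indicator {ω | H ω = k} (fun _ => (1 : ℝ)))
      (fun k _ => (integrable_const 1).indicator (hA k)) (MeasurableSpace.comap X inferInstance)
    rw [hsum, condExp_const hX.comap_le] at h
    filter_upwards [h, ae_all_iff.2 hwX] with ω h1 h2
    rw [Finset.sum_apply] at h1
    simp only [h2] at h1
    exact h1.symm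
  have hloc : ∀ᵐ ω ∂μ, ∀ k, w k (X ω) ≠ 0 → 0 < ek k (X ω) ∧ ek k (X ω) < 1 := by
    refine ae_all_iff.2 fun k => ?_
    have hS : MeasurableSet {x | 0 < ek k x ∧ ek k x < 1} :=
      (measurableSet_lt measurable_const (hekMeas k)).inter
        (measurableSet_lt (hekMeas k) measurable_const)
    have h : ∀ᵐ ω ∂μ.restrict {ω | H ω = k}, 0 < ek k (X ω) ∧ ek k (X ω) < 1 := by
      have h := hLoc k
      rwa [ProbabilityTheory.cond, Measure.ae_ennreal_smul_measure_iff (by simp)] at h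
    rw [← ae_map_iff hX.aemeasurable hS, hlaw k,
      ae_withDensity_iff (hwMeas k).ennreal_ofReal] at h
    filter_upwards [ae_of_ae_map hX.aemeasurable h, hw0] with ω h1 h2 h3
    exact h1 (by simpa using lt_of_le_of_ne (h2 k) h3.symm)
  have hg : ∀ k, Measurable fun x => ENNReal.ofReal ((ek k x * (1 - ek k x))⁻¹) := fun k =>
    ((hekMeas k).mul (measurable_const.sub (hekMeas k))).inv.ennreal_ofReal
  have hsite : ∀ k, μ {ω | H ω = k} *
        ∫⁻ ω, ENNReal.ofReal ((ek k (X ω) * (1 - ek k (X ω)))⁻¹) ∂(μ[|{ω | H ω = k}])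
      = ∫⁻ ω, ENNReal.ofReal (w k (X ω)) *
          ENNReal.ofReal ((ek k (X ω) * (1 - ek k (X ω)))⁻¹) ∂μ := by
    intro k
    have hrestrict : μ {ω | H ω = k} • μ[|{ω | H ω = k}] = μ.restrict {ω | H ω = k} := by
      by_cases h : μ {ω | H ω = k} = 0
      · simp [h, Measure.restrict_eq_zero.2 h]
      · rw [ProbabilityTheory.cond, smul_smul, ENNReal.mul_inv_cancel h (measure_ne_top _ _),
          one_smul]
    rw [← smul_eq_mul, ← lintegral_smul_measure, hrestrict, ← lintegral_map (hg k) hX, hlaw k,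
      lintegral_withDensity_eq_lintegral_mul _ (hwMeas k).ennreal_ofReal (hg k),
      lintegral_map ((hwMeas k).ennreal_ofReal.mul (hg k)) hX]
    rfl
  simp only [hsite]
  rw [← lintegral_finsetSum Finset.univ (by fun_prop)]
  refine lintegral_mono_ae ?_
  filter_upwards [hw0, hw1, hloc, hMix] with ω h0 h1 h2 h3
  rw [h3]
  simp only [← ENNReal.ofReal_mul (h0 _)]
  rw [← ENNReal.ofReal_sum_of_nonneg]
  · exact ENNReal.ofReal_le_ofReal (inv_mul_one_sub_sum_le _ _ h0 h1 h2)
  · intro k _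
    by_cases h : w k (X ω) = 0
    · simp [h]
    · exact mul_nonneg (h0 k)
        (inv_nonneg.2 (mul_nonneg (h2 k h).1.le (sub_nonneg.2 (h2 k h).2.le)))
end
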